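/- arXiv:math/0507276 — 2 statements merged into one kernel-verified Lean document; each statement's English description precedes it below -/
import Mathlib

section
/- Let κ = 2 and n = 2. The function φ(x₁,x₂,x₃,x₄) = 1/((x₁−x₂)²(x₃−x₄)²) − 1/((x₁−x₃)²(x₂−x₄)²) is annihilated by the operator L₁ = ∂₁₁ + Σ_{l≠1} 2∂_l/(x_l−x₁) − 2 Σ_{l≠1} 1/(x_l−x₁)², at every point with x₁, x₂, x₃, x₄ pairwise distinct. -/
/-- The Fomin-type determinant solution for `κ = 2`, `n = 2`. -/
noncomputable def φ (x₁ x₂ x₃ x₄ : ℝ) : ℝ :=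
  1 / ((x₁ - x₂) ^ 2 * (x₃ - x₄) ^ 2) - 1 / ((x₁ - x₃) ^ 2 * (x₂ - x₄) ^ 2)

/-- The derivative of an inverse square. -/
theorem HasDerivAt.one_div_sq {f : ℝ → ℝ} {f' x : ℝ} (hf : HasDerivAt f f' x) (hx : f x ≠ 0) :
    HasDerivAt (fun t => 1 / f t ^ 2) (-2 * f' / f x ^ 3) x := by
  have h := (hf.fun_pow 2).fun_inv (pow_ne_zero 2 hx)
  simp only [one_div]
  refine h.congr_deriv ?_
  field_simp
  push_cast
  ring

/-- The derivative of an inverse cube. -/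
theorem HasDerivAt.one_div_cube {f : ℝ → ℝ} {f' x : ℝ} (hf : HasDerivAt f f' x) (hx : f x ≠ 0) :
    HasDerivAt (fun t => 1 / f t ^ 3) (-3 * f' / f x ^ 4) x := by
  have h := (hf.fun_pow 3).fun_inv (pow_ne_zero 3 hx)
  simp only [one_div]
  refine h.congr_deriv ?_
  field_simp
  push_cast
  ring

theorem φ_eq_mul (x₁ x₂ x₃ x₄ : ℝ) :
    φ x₁ x₂ x₃ x₄ = 1 / (x₁ - x₂) ^ 2 * (1 / (x₃ - x₄) ^ 2)
      - 1 / (x₁ - x₃) ^ 2 * (1 / (x₂ - x₄) ^ 2) := by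
  simp only [φ, one_div, mul_inv]

theorem hasDerivAt_φ_fst {x₁ x₂ x₃ : ℝ} (x₄ : ℝ) (h₁₂ : x₁ ≠ x₂) (h₁₃ : x₁ ≠ x₃) :
    HasDerivAt (fun t => φ t x₂ x₃ x₄)
      (-2 * (1 / (x₁ - x₂) ^ 3) * (1 / (x₃ - x₄) ^ 2)
        + 2 * (1 / (x₁ - x₃) ^ 3) * (1 / (x₂ - x₄) ^ 2)) x₁ := by
  simp only [φ_eq_mul]
  have h₂ := ((hasDerivAt_id' x₁).sub_const x₂).one_div_sq (sub_ne_zero.2 h₁₂)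
  have h₃ := ((hasDerivAt_id' x₁).sub_const x₃).one_div_sq (sub_ne_zero.2 h₁₃)
  refine ((h₂.mul_const (1 / (x₃ - x₄) ^ 2)).fun_sub
    (h₃.mul_const (1 / (x₂ - x₄) ^ 2))).congr_deriv ?_
  ring

theorem deriv_deriv_φ_fst {x₁ x₂ x₃ : ℝ} (x₄ : ℝ) (h₁₂ : x₁ ≠ x₂) (h₁₃ : x₁ ≠ x₃) :
    deriv (deriv (fun t => φ t x₂ x₃ x₄)) x₁
      = 6 / (x₁ - x₂) ^ 4 * (1 / (x₃ - x₄) ^ 2) - 6 / (x₁ - x₃) ^ 4 * (1 / (x₂ - x₄) ^ 2) := by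
  have hev : deriv (fun t => φ t x₂ x₃ x₄) =ᶠ[nhds x₁] fun t =>
      -2 * (1 / (t - x₂) ^ 3) * (1 / (x₃ - x₄) ^ 2)
        + 2 * (1 / (t - x₃) ^ 3) * (1 / (x₂ - x₄) ^ 2) := by
    filter_upwards [isOpen_ne.mem_nhds h₁₂, isOpen_ne.mem_nhds h₁₃] with t h₂ h₃
    exact (hasDerivAt_φ_fst x₄ h₂ h₃).deriv
  rw [hev.deriv_eq]
  have h₂ := ((hasDerivAt_id' x₁).sub_const x₂).one_div_cube (sub_ne_zero.2 h₁₂)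
  have h₃ := ((hasDerivAt_id' x₁).sub_const x₃).one_div_cube (sub_ne_zero.2 h₁₃)
  rw [(((h₂.const_mul (-2)).mul_const (1 / (x₃ - x₄) ^ 2)).fun_add
    ((h₃.const_mul 2).mul_const (1 / (x₂ - x₄) ^ 2))).deriv]
  ring

theorem deriv_φ_snd {x₁ x₂ x₄ : ℝ} (x₃ : ℝ) (h₁₂ : x₁ ≠ x₂) (h₂₄ : x₂ ≠ x₄) :
    deriv (fun t => φ x₁ t x₃ x₄) x₂
      = 2 / (x₁ - x₂) ^ 3 * (1 / (x₃ - x₄) ^ 2) + 1 / (x₁ - x₃) ^ 2 * (2 / (x₂ - x₄) ^ 3) := by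
  simp only [φ_eq_mul]
  have h₁ := ((hasDerivAt_id' x₂).const_sub x₁).one_div_sq (sub_ne_zero.2 h₁₂)
  have h₄ := ((hasDerivAt_id' x₂).sub_const x₄).one_div_sq (sub_ne_zero.2 h₂₄)
  rw [((h₁.mul_const (1 / (x₃ - x₄) ^ 2)).fun_sub (h₄.const_mul (1 / (x₁ - x₃) ^ 2))).deriv]
  ring

theorem φ_swap (x₁ x₂ x₃ x₄ : ℝ) : φ x₁ x₂ x₃ x₄ = -φ x₁ x₃ x₂ x₄ := by
  simp only [φ, neg_sub]

theorem deriv_φ_trd {x₁ x₃ x₄ : ℝ} (x₂ : ℝ) (h₁₃ : x₁ ≠ x₃) (h₃₄ : x₃ ≠ x₄) :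
    deriv (fun t => φ x₁ x₂ t x₄) x₃
      = -(2 / (x₁ - x₃) ^ 3 * (1 / (x₂ - x₄) ^ 2)
        + 1 / (x₁ - x₂) ^ 2 * (2 / (x₃ - x₄) ^ 3)) := by
  simp only [φ_swap x₁ x₂, deriv.fun_neg, deriv_φ_snd x₂ h₁₃ h₃₄]

theorem deriv_φ_fourth {x₂ x₃ x₄ : ℝ} (x₁ : ℝ) (h₂₄ : x₂ ≠ x₄) (h₃₄ : x₃ ≠ x₄) :
    deriv (fun t => φ x₁ x₂ x₃ t) x₄
      = 1 / (x₁ - x₂) ^ 2 * (2 / (x₃ - x₄) ^ 3) - 1 / (x₁ - x₃) ^ 2 * (2 / (x₂ - x₄) ^ 3) := by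
  simp only [φ_eq_mul]
  have h₃ := ((hasDerivAt_id' x₄).const_sub x₃).one_div_sq (sub_ne_zero.2 h₃₄)
  have h₂ := ((hasDerivAt_id' x₄).const_sub x₂).one_div_sq (sub_ne_zero.2 h₂₄)
  rw [((h₃.const_mul (1 / (x₁ - x₂) ^ 2)).fun_sub (h₂.const_mul (1 / (x₁ - x₃) ^ 2))).deriv]
  ring

/-- `φ` is annihilated by `L₁ = ∂₁₁ + Σ_{l≠1} 2∂_l/(x_l−x₁) − 2 Σ_{l≠1} 1/(x_l−x₁)²`
(the operator `(κ/2)∂₁₁ + Σ 2∂_l/(x_l−x₁) + ((κ−6)/κ) Σ 1/(x_l−x₁)²` at `κ = 2`). -/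
theorem stmt_8 (x₁ x₂ x₃ x₄ : ℝ)
    (h : x₁ ≠ x₂ ∧ x₁ ≠ x₃ ∧ x₁ ≠ x₄ ∧ x₂ ≠ x₃ ∧ x₂ ≠ x₄ ∧ x₃ ≠ x₄) :
    deriv (deriv (fun t => φ t x₂ x₃ x₄)) x₁
      + (2 / (x₂ - x₁)) * deriv (fun t => φ x₁ t x₃ x₄) x₂
      + (2 / (x₃ - x₁)) * deriv (fun t => φ x₁ x₂ t x₄) x₃
      + (2 / (x₄ - x₁)) * deriv (fun t => φ x₁ x₂ x₃ t) x₄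
      - 2 * (1 / (x₂ - x₁) ^ 2 + 1 / (x₃ - x₁) ^ 2 + 1 / (x₄ - x₁) ^ 2) * φ x₁ x₂ x₃ x₄
      = 0 := by
  obtain ⟨h₁₂, h₁₃, h₁₄, -, h₂₄, h₃₄⟩ := h
  rw [deriv_deriv_φ_fst x₄ h₁₂ h₁₃, deriv_φ_snd x₃ h₁₂ h₂₄, deriv_φ_trd x₂ h₁₃ h₃₄,
    deriv_φ_fourth x₁ h₂₄ h₃₄, φ_eq_mul]
  have h₂₁ := sub_ne_zero.2 h₁₂.symm
  have h₃₁ := sub_ne_zero.2 h₁₃.symm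
  have h₄₁ := sub_ne_zero.2 h₁₄.symm
  rw [← neg_sub x₂ x₁, ← neg_sub x₃ x₁, ← sub_sub_sub_cancel_right x₂ x₄ x₁,
    ← sub_sub_sub_cancel_right x₃ x₄ x₁]
  have h₂₄' : x₂ - x₁ - (x₄ - x₁) ≠ 0 := by simpa [sub_eq_zero] using h₂₄
  have h₃₄' : x₃ - x₁ - (x₄ - x₁) ≠ 0 := by simpa [sub_eq_zero] using h₃₄
  generalize x₂ - x₁ = a at *
  generalize x₃ - x₁ = b at *
  generalize x₄ - x₁ = c at *
  field_simp
  ring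
end

section
/- Every polynomial in 2n real variables that is annihilated by all the operators ∂²/∂x_k² (k = 1,...,2n), by Σ_k ∂_k, and is homogeneous of degree n (i.e. annihilated by Σ_k x_k ∂_k − n), has partial degree at most 1 in each variable; the vector space of such polynomials has dimension C(2n,n) − C(2n,n−1) = C_n. -/
open MvPolynomial

/-- The space of polynomials in `2n` variables annihilated by all `∂²/∂x_k²`,
by `Σ_k ∂_k`, and by the Euler operator `Σ_k x_k ∂_k − n` (homogeneity of degree `n`). -/
noncomputable def harmSpace (n : ℕ) : Submodule ℝ (MvPolynomial (Fin (2 * n)) ℝ) :=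
  (⨅ k : Fin (2 * n), LinearMap.ker (((pderiv (R := ℝ) k).toLinearMap).comp (pderiv k).toLinearMap)) ⊓
    LinearMap.ker (∑ k : Fin (2 * n), (pderiv (R := ℝ) k).toLinearMap) ⊓
    LinearMap.ker
      ((∑ k : Fin (2 * n), (LinearMap.mulLeft ℝ (X k)).comp ((pderiv (R := ℝ) k).toLinearMap))
        - (n : ℝ) • LinearMap.id)

section BooleanLattice

variable {ι : Type*} [DecidableEq ι]

/-- The operator `(∂_i f)(S) = f (insert i S)` for `i ∉ S`, and `0` for `i ∈ S`. -/
def removeAt (i : ι) : (Finset ι → ℝ) →ₗ[ℝ] (Finset ι → ℝ) where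
  toFun f S := if i ∈ S then 0 else f (insert i S)
  map_add' f g := by ext S; by_cases h : i ∈ S <;> simp [h]
  map_smul' c f := by ext S; by_cases h : i ∈ S <;> simp [h]

/-- The transpose of `removeAt i`. -/
def insertAt (i : ι) : (Finset ι → ℝ) →ₗ[ℝ] (Finset ι → ℝ) where
  toFun f S := if i ∈ S then f (S.erase i) else 0
  map_add' f g := by ext S; by_cases h : i ∈ S <;> simp [h]
  map_smul' c f := by ext S; by_cases h : i ∈ S <;> simp [h]

theorem removeAt_apply (i : ι) (f : Finset ι → ℝ) (S : Finset ι) :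
    removeAt i f S = if i ∈ S then 0 else f (insert i S) := rfl

theorem insertAt_apply (i : ι) (f : Finset ι → ℝ) (S : Finset ι) :
    insertAt i f S = if i ∈ S then f (S.erase i) else 0 := rfl

theorem removeAt_insertAt_of_ne {i j : ι} (h : i ≠ j) (f : Finset ι → ℝ) :
    removeAt i (insertAt j f) = insertAt j (removeAt i f) := by
  ext S
  simp only [removeAt_apply, insertAt_apply, Finset.mem_insert, Finset.mem_erase]
  by_cases hi : i ∈ S <;> by_cases hj : j ∈ S <;> simp [hi, hj, h, h.symm]
  rw [Finset.erase_insert_of_ne h]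

theorem removeAt_insertAt_self (i : ι) (f : Finset ι → ℝ) (S : Finset ι) :
    removeAt i (insertAt i f) S =
      insertAt i (removeAt i f) S + (1 - 2 * if i ∈ S then 1 else 0) * f S := by
  simp only [removeAt_apply, insertAt_apply]
  by_cases hi : i ∈ S <;> simp [hi, Finset.insert_erase]
  ring

variable [Fintype ι]

/-- The lowering operator of the Boolean lattice. -/
def lower : (Finset ι → ℝ) →ₗ[ℝ] (Finset ι → ℝ) := ∑ i, removeAt i

/-- The raising operator of the Boolean lattice. -/
def raise : (Finset ι → ℝ) →ₗ[ℝ] (Finset ι → ℝ) := ∑ i, insertAt i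

/-- Functions on finite subsets supported on subsets of cardinality `k`. -/
def levelSpace (ι : Type*) (k : ℕ) : Submodule ℝ (Finset ι → ℝ) where
  carrier := {f | ∀ S, S.card ≠ k → f S = 0}
  add_mem' hf hg S hS := by simp [hf S hS, hg S hS]
  zero_mem' S _ := rfl
  smul_mem' c f hf S hS := by simp [hf S hS]

theorem lower_apply (f : Finset ι → ℝ) (S : Finset ι) :
    lower f S = ∑ i, if i ∈ S then 0 else f (insert i S) := by
  simp [lower, LinearMap.sum_apply, Finset.sum_apply, removeAt_apply]

theorem raise_apply (f : Finset ι → ℝ) (S : Finset ι) :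
    raise f S = ∑ i, if i ∈ S then f (S.erase i) else 0 := by
  simp [raise, LinearMap.sum_apply, Finset.sum_apply, insertAt_apply]

theorem lower_raise (f : Finset ι → ℝ) (S : Finset ι) :
    lower (raise f) S = raise (lower f) S + ((Fintype.card ι : ℝ) - 2 * S.card) * f S := by
  have key (i j : ι) : removeAt i (insertAt j f) S = insertAt j (removeAt i f) S +
      if i = j then (1 - 2 * if i ∈ S then 1 else 0) * f S else 0 := by
    by_cases h : i = j
    · subst h; simp [removeAt_insertAt_self]
    · simp [h, removeAt_insertAt_of_ne h]
  simp only [lower, raise, LinearMap.sum_apply, map_sum, Finset.sum_apply, key,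
    Finset.sum_add_distrib]
  rw [Finset.sum_comm]
  congr 1
  rw [Finset.sum_comm]
  simp only [Finset.sum_ite_eq, Finset.mem_univ, if_true]
  rw [← Finset.sum_mul, Finset.sum_sub_distrib, ← Finset.mul_sum]
  simp

theorem sum_insertAt_mul (i : ι) (f g : Finset ι → ℝ) :
    ∑ S, insertAt i f S * g S = ∑ S, f S * removeAt i g S := by
  have hinv : Function.Involutive fun S : Finset ι => if i ∈ S then S.erase i else insert i S := by
    intro S
    by_cases h : i ∈ S <;> simp [h]
  refine Fintype.sum_bijective _ hinv.bijective _ _ fun S => ?_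
  by_cases h : i ∈ S <;> simp [insertAt_apply, removeAt_apply, h]

theorem sum_raise_mul (f g : Finset ι → ℝ) :
    ∑ S, raise f S * g S = ∑ S, f S * lower g S := by
  simp only [lower, raise, LinearMap.sum_apply, Finset.sum_apply, Finset.sum_mul, Finset.mul_sum]
  rw [Finset.sum_comm, Finset.sum_comm (s := Finset.univ (α := Finset ι))]
  exact Finset.sum_congr rfl fun i _ => sum_insertAt_mul i f g

theorem lower_mem_levelSpace {k : ℕ} {f : Finset ι → ℝ} (hf : f ∈ levelSpace ι (k + 1)) :
    lower f ∈ levelSpace ι k := by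
  intro S hS
  rw [lower_apply]
  refine Finset.sum_eq_zero fun i _ => ?_
  split_ifs with h
  · rfl
  · exact hf _ (by rw [Finset.card_insert_of_notMem h]; omega)

theorem raise_mem_levelSpace {k : ℕ} {f : Finset ι → ℝ} (hf : f ∈ levelSpace ι k) :
    raise f ∈ levelSpace ι (k + 1) := by
  intro S hS
  rw [raise_apply]
  refine Finset.sum_eq_zero fun i _ => ?_
  split_ifs with h
  · exact hf _ (by have := Finset.card_erase_add_one h; omega)
  · rfl

theorem eq_zero_of_lower_raise_eq_zero {k : ℕ} (hk : 2 * k < Fintype.card ι)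
    {f : Finset ι → ℝ} (hf : f ∈ levelSpace ι k) (h : lower (raise f) = 0) : f = 0 := by
  have h1 : ∑ S, (lower f S * lower f S +
      ((Fintype.card ι : ℝ) - 2 * k) * (f S * f S)) = 0 := by
    rw [Finset.sum_add_distrib, ← sum_raise_mul, ← Finset.sum_add_distrib]
    refine Finset.sum_eq_zero fun S _ => ?_
    have h2 := lower_raise f S
    rw [h] at h2
    by_cases hS : S.card = k
    · rw [hS] at h2
      simp only [Pi.zero_apply] at h2
      linear_combination (-f S) * h2
    · simp [hf S hS]
  have hpos : (0 : ℝ) < (Fintype.card ι : ℝ) - 2 * k := by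
    have : ((2 * k : ℕ) : ℝ) < Fintype.card ι := by exact_mod_cast hk
    push_cast at this
    linarith
  rw [Finset.sum_eq_zero_iff_of_nonneg fun S _ =>
    add_nonneg (mul_self_nonneg _) (mul_nonneg hpos.le (mul_self_nonneg _))] at h1
  ext S
  have h3 := h1 S (Finset.mem_univ S)
  have h4 : f S * f S = 0 := by
    nlinarith [mul_self_nonneg (lower f S), mul_self_nonneg (f S)]
  simpa using h4

theorem map_lower_levelSpace {k : ℕ} (hk : 2 * k < Fintype.card ι) :
    (levelSpace ι (k + 1)).map lower = levelSpace ι k := by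
  apply le_antisymm
  · rintro _ ⟨f, hf, rfl⟩
    exact lower_mem_levelSpace hf
  · intro g hg
    let T : levelSpace ι k →ₗ[ℝ] levelSpace ι k :=
      (lower ∘ₗ raise).restrict fun f hf => lower_mem_levelSpace (raise_mem_levelSpace hf)
    have hT : Function.Injective T := by
      rw [← LinearMap.ker_eq_bot, LinearMap.ker_eq_bot']
      intro f hf
      exact Subtype.ext (eq_zero_of_lower_raise_eq_zero hk f.2 (congrArg Subtype.val hf))
    obtain ⟨f, hf⟩ := LinearMap.injective_iff_surjective.mp hT ⟨g, hg⟩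
    exact ⟨raise f, raise_mem_levelSpace f.2, congrArg Subtype.val hf⟩

/-- Functions supported on level `k` are functions on the subsets of cardinality `k`. -/
def levelSpaceEquiv (ι : Type*) (k : ℕ) :
    levelSpace ι k ≃ₗ[ℝ] ({S : Finset ι // S.card = k} → ℝ) where
  toFun f S := f.1 S
  map_add' _ _ := rfl
  map_smul' _ _ := rfl
  invFun g := ⟨fun S => if h : S.card = k then g ⟨S, h⟩ else 0, fun S hS => by simp [hS]⟩
  left_inv f := by
    ext S
    by_cases h : S.card = k
    · simp [h]
    · simp [h, f.2 S h]
  right_inv g := by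
    ext S
    simp [S.2]

theorem finrank_levelSpace {ι : Type*} [Fintype ι] (k : ℕ) :
    Module.finrank ℝ (levelSpace ι k) = (Fintype.card ι).choose k := by
  rw [(levelSpaceEquiv ι k).finrank_eq, Module.finrank_fintype_fun_eq_card,
    Fintype.card_finset_len]

theorem finrank_ker_lower_inf_levelSpace {k : ℕ} (hk : 2 * k < Fintype.card ι) :
    Module.finrank ℝ ↥(LinearMap.ker lower ⊓ levelSpace ι (k + 1)) =
      (Fintype.card ι).choose (k + 1) - (Fintype.card ι).choose k := by
  have h := LinearMap.finrank_range_add_finrank_ker (lower.domRestrict (levelSpace ι (k + 1)))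
  rw [LinearMap.range_domRestrict, map_lower_levelSpace hk, finrank_levelSpace,
    finrank_levelSpace, ← Submodule.finrank_map_subtype_eq, LinearMap.ker_domRestrict,
    Submodule.map_comap_subtype, inf_comm] at h
  omega

end BooleanLattice

section SquarefreeMonomials

variable {ι : Type*} [Fintype ι] [DecidableEq ι]

/-- The exponent vector of the squarefree monomial `∏ i ∈ S, X i`. -/
noncomputable def squarefreeExp (S : Finset ι) : ι →₀ ℕ :=
  Finsupp.equivFunOnFinite.symm fun i => if i ∈ S then 1 else 0

theorem squarefreeExp_apply (S : Finset ι) (i : ι) :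
    squarefreeExp S i = if i ∈ S then 1 else 0 := rfl

theorem squarefreeExp_injective : Function.Injective (squarefreeExp (ι := ι)) := by
  intro S T h
  ext i
  have := DFunLike.congr_fun h i
  simp only [squarefreeExp_apply] at this
  grind

theorem squarefreeExp_insert {S : Finset ι} {i : ι} (h : i ∉ S) :
    squarefreeExp (insert i S) = squarefreeExp S + Finsupp.single i 1 := by
  ext j
  simp only [squarefreeExp_apply, Finsupp.add_apply, Finsupp.single_apply, Finset.mem_insert]
  grind

theorem sum_squarefreeExp (S : Finset ι) : ∑ i, squarefreeExp S i = S.card := by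
  simp [squarefreeExp_apply]

theorem exists_squarefreeExp_eq {m : ι →₀ ℕ} (h : ∀ i, m i ≤ 1) :
    ∃ S, squarefreeExp S = m := by
  refine ⟨m.support, ?_⟩
  ext i
  have := h i
  simp only [squarefreeExp_apply, Finsupp.mem_support_iff]
  grind

/-- The coefficients of the squarefree monomials of a polynomial. -/
noncomputable def squarefreeCoeff : MvPolynomial ι ℝ →ₗ[ℝ] (Finset ι → ℝ) :=
  LinearMap.pi fun S => MvPolynomial.lcoeff ℝ (squarefreeExp S)

theorem squarefreeCoeff_apply (p : MvPolynomial ι ℝ) (S : Finset ι) :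
    squarefreeCoeff p S = coeff (squarefreeExp S) p := rfl

/-- The multilinear polynomial with prescribed coefficients. -/
noncomputable def multilinearPoly (f : Finset ι → ℝ) : MvPolynomial ι ℝ :=
  ∑ S, monomial (squarefreeExp S) (f S)

theorem coeff_squarefreeExp_multilinearPoly (f : Finset ι → ℝ) (S : Finset ι) :
    coeff (squarefreeExp S) (multilinearPoly f) = f S := by
  simp [multilinearPoly, coeff_sum, coeff_monomial, squarefreeExp_injective.eq_iff]

theorem coeff_multilinearPoly_of_one_lt (f : Finset ι → ℝ) {m : ι →₀ ℕ} {i : ι} (h : 1 < m i) :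
    coeff m (multilinearPoly f) = 0 := by
  rw [multilinearPoly, coeff_sum]
  refine Finset.sum_eq_zero fun S _ => ?_
  rw [coeff_monomial, if_neg]
  rintro rfl
  rw [squarefreeExp_apply] at h
  grind

end SquarefreeMonomials

theorem coeff_X_mul_pderiv {ι : Type*} (i : ι) (p : MvPolynomial ι ℝ) (m : ι →₀ ℕ) :
    coeff m (X i * pderiv i p) = m i * coeff m p := by
  classical
  rw [coeff_X_mul']
  split_ifs with h
  · have h1 : 1 ≤ m i := Nat.one_le_iff_ne_zero.mpr (Finsupp.mem_support_iff.mp h)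
    have h2 : m - Finsupp.single i 1 + Finsupp.single i 1 = m :=
      tsub_add_cancel_of_le (Finsupp.single_le_iff.mpr h1)
    rw [coeff_pderiv, h2, mul_comm]
    simp [Nat.cast_sub h1]
  · simp [Finsupp.notMem_support_iff.mp h]

theorem mem_harmSpace_iff {n : ℕ} {p : MvPolynomial (Fin (2 * n)) ℝ} :
    p ∈ harmSpace n ↔
      (∀ k m, 1 < m k → coeff m p = 0) ∧
      (∀ m, ∑ k, coeff (m + Finsupp.single k 1) p * (m k + 1) = 0) ∧
      (∀ m, ∑ k, m k ≠ n → coeff m p = 0) := by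
  simp only [harmSpace, Submodule.mem_inf, Submodule.mem_iInf, LinearMap.mem_ker, and_assoc]
  refine and_congr ?_ (and_congr ?_ ?_)
  · refine forall_congr' fun k => ?_
    constructor
    · intro h m hm
      have h2 : m - Finsupp.single k 2 + Finsupp.single k 1 + Finsupp.single k 1 = m := by
        rw [add_assoc, ← Finsupp.single_add]
        exact tsub_add_cancel_of_le (Finsupp.single_le_iff.mpr hm)
      have h3 := congrArg (coeff (m - Finsupp.single k 2)) h
      simp only [LinearMap.comp_apply, Derivation.coeFn_coe, coeff_pderiv, h2, coeff_zero] at h3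
      refine (mul_eq_zero.mp ((mul_eq_zero.mp h3).resolve_right ?_)).resolve_right ?_ <;>
        positivity
    · intro h
      ext m
      simp only [LinearMap.comp_apply, Derivation.coeFn_coe, coeff_pderiv, coeff_zero]
      rw [h _ (by simp), zero_mul, zero_mul]
  · rw [MvPolynomial.ext_iff]
    simp [LinearMap.sum_apply, coeff_sum, coeff_pderiv]
  · rw [MvPolynomial.ext_iff]
    refine forall_congr' fun m => ?_
    simp only [LinearMap.sub_apply, LinearMap.sum_apply, LinearMap.comp_apply,
      Derivation.coeFn_coe, LinearMap.mulLeft_apply, LinearMap.smul_apply, LinearMap.id_apply,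
      coeff_sub, coeff_sum, coeff_X_mul_pderiv, coeff_smul, coeff_zero, smul_eq_mul,
      ← Finset.sum_mul, ← sub_mul, mul_eq_zero, sub_eq_zero]
    norm_cast
    tauto

theorem map_squarefreeCoeff_harmSpace (n : ℕ) :
    (harmSpace n).map squarefreeCoeff = LinearMap.ker lower ⊓ levelSpace (Fin (2 * n)) n := by
  have key (p : MvPolynomial (Fin (2 * n)) ℝ) (hp : ∀ k m, 1 < m k → coeff m p = 0)
      (S : Finset (Fin (2 * n))) :
      lower (squarefreeCoeff p) S = ∑ k, coeff (squarefreeExp S + Finsupp.single k 1) p *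
        ((squarefreeExp S k : ℕ) + 1) := by
    rw [lower_apply]
    refine Finset.sum_congr rfl fun k _ => ?_
    split_ifs with h
    · rw [hp k _ (by simp [squarefreeExp_apply, h]), zero_mul]
    · simp [squarefreeCoeff_apply, squarefreeExp_insert h, squarefreeExp_apply, h]
  apply le_antisymm
  · rintro _ ⟨p, hp, rfl⟩
    obtain ⟨h1, h2, h3⟩ := mem_harmSpace_iff.mp hp
    refine ⟨?_, fun S hS => h3 _ (by rwa [sum_squarefreeExp])⟩
    rw [SetLike.mem_coe, LinearMap.mem_ker]
    ext S
    rw [key p h1, h2, Pi.zero_apply]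
  · rintro f ⟨hf, hfn⟩
    have hc : squarefreeCoeff (multilinearPoly f) = f :=
      funext (coeff_squarefreeExp_multilinearPoly f)
    have h1 : ∀ k m, 1 < m k → coeff m (multilinearPoly f) = 0 :=
      fun k m => coeff_multilinearPoly_of_one_lt f
    refine ⟨multilinearPoly f, mem_harmSpace_iff.mpr ⟨h1, fun m => ?_, fun m hm => ?_⟩, hc⟩
    · by_cases hm : ∀ k, m k ≤ 1
      · obtain ⟨S, rfl⟩ := exists_squarefreeExp_eq hm
        rw [← key _ h1, hc, LinearMap.mem_ker.mp hf, Pi.zero_apply]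
      · push Not at hm
        obtain ⟨k, hk⟩ := hm
        refine Finset.sum_eq_zero fun j _ => ?_
        rw [h1 k _ (by rw [Finsupp.add_apply]; omega), zero_mul]
    · by_cases hm' : ∀ k, m k ≤ 1
      · obtain ⟨S, rfl⟩ := exists_squarefreeExp_eq hm'
        rw [coeff_squarefreeExp_multilinearPoly]
        exact hfn S (by rwa [sum_squarefreeExp] at hm)
      · push Not at hm'
        obtain ⟨k, hk⟩ := hm'
        exact h1 k m hk

theorem finrank_harmSpace_eq (n : ℕ) :
    Module.finrank ℝ (harmSpace n) =
      Module.finrank ℝ ↥(LinearMap.ker lower ⊓ levelSpace (Fin (2 * n)) n) := by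
  rw [← map_squarefreeCoeff_harmSpace, ← LinearMap.range_domRestrict,
    LinearMap.finrank_range_of_inj]
  rw [← LinearMap.ker_eq_bot, LinearMap.ker_eq_bot']
  rintro ⟨p, hp⟩ h
  ext m
  by_cases hm : ∀ k, m k ≤ 1
  · obtain ⟨S, rfl⟩ := exists_squarefreeExp_eq hm
    exact congrFun h S
  · push Not at hm
    obtain ⟨k, hk⟩ := hm
    exact (mem_harmSpace_iff.mp hp).1 k m hk

theorem choose_sub_choose_eq_catalan (m : ℕ) :
    (2 * (m + 1)).choose (m + 1) - (2 * (m + 1)).choose m = catalan (m + 1) := by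
  have h1 := succ_mul_catalan_eq_centralBinom (m + 1)
  have h2 := Nat.choose_succ_right_eq (2 * (m + 1)) m
  rw [Nat.centralBinom] at h1
  rw [show 2 * (m + 1) - m = m + 2 by omega] at h2
  have h3 : (2 * (m + 1)).choose (m + 1) = (2 * (m + 1)).choose m + catalan (m + 1) := by
    apply Nat.eq_of_mul_eq_mul_left (show 0 < m + 2 by omega)
    linarith
  omega

theorem stmt_10 (n : ℕ) (hn : 1 ≤ n) :
    (∀ p ∈ harmSpace n, ∀ k : Fin (2 * n), MvPolynomial.degreeOf k p ≤ 1) ∧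
    Module.finrank ℝ (harmSpace n) = Nat.choose (2 * n) n - Nat.choose (2 * n) (n - 1) ∧
    Nat.choose (2 * n) n - Nat.choose (2 * n) (n - 1) = catalan n := by
  obtain ⟨m, rfl⟩ : ∃ m, n = m + 1 := ⟨n - 1, by omega⟩
  refine ⟨fun p hp k => ?_, ?_, choose_sub_choose_eq_catalan m⟩
  · rw [degreeOf_le_iff]
    intro d hd
    by_contra! h
    exact mem_support_iff.mp hd ((mem_harmSpace_iff.mp hp).1 k d h)
  · rw [finrank_harmSpace_eq, finrank_ker_lower_inf_levelSpace (by simp), Fintype.card_fin,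
      Nat.add_sub_cancel]
end
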